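/- arXiv:1906.09865 — 4 statements merged into one kernel-verified Lean document; each statement's English description precedes it below -/
import Mathlib

section
/- In an atomic parallel-link congestion game with n ≥ 1 players and finite nonempty edge set E, for every state S there exists a toll vector implementing S, and the minimum number of tolled edges over all toll vectors implementing S equals the number of edges e ∈ E with l_e^+ < L(S), i.e. with c_e(n_e(S)+1) < L(S). -/
/-!
Atomic parallel-link congestion game: finite nonempty edge set `E`, `n ≥ 1` players,
nonnegative monotone cost functions `c e : ℕ → ℝ`.  A state is `S : Fin n → E`.
-/

/-- Congestion of edge `e` in state `S`: the number of players using `e`. -/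
def cong {E : Type*} [Fintype E] [DecidableEq E] {n : ℕ} (S : Fin n → E) (e : E) : ℕ :=
  (Finset.univ.filter fun i => S i = e).card

/-- `L(S)`, the maximum player cost in state `S` (requires `n ≥ 1`). -/
def maxCost {E : Type*} [Fintype E] [DecidableEq E] (c : E → ℕ → ℝ) {n : ℕ}
    (hn : 1 ≤ n) (S : Fin n → E) : ℝ :=
  haveI : Nonempty (Fin n) := ⟨⟨0, hn⟩⟩
  Finset.univ.sup' Finset.univ_nonempty fun i => c (S i) (cong S (S i))

/-- The toll vector `θ` implements state `S`: `S` is a pure Nash equilibrium of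
the tolled game. -/
def Implements {E : Type*} [Fintype E] [DecidableEq E] (c : E → ℕ → ℝ) {n : ℕ}
    (θ : E → ℝ) (S : Fin n → E) : Prop :=
  ∀ i : Fin n, ∀ e : E, e ≠ S i →
    c (S i) (cong S (S i)) + θ (S i) ≤ c e (cong S e + 1) + θ e

section ParallelLink

variable {E : Type*} [Fintype E] [DecidableEq E] (c : E → ℕ → ℝ) {n : ℕ}

theorem le_maxCost (hn : 1 ≤ n) (S : Fin n → E) (i : Fin n) :
    c (S i) (cong S (S i)) ≤ maxCost c hn S :=
  Finset.le_sup' (fun i => c (S i) (cong S (S i))) (Finset.mem_univ i)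

theorem exists_eq_maxCost (hn : 1 ≤ n) (S : Fin n → E) :
    ∃ i, maxCost c hn S = c (S i) (cong S (S i)) := by
  have : Nonempty (Fin n) := ⟨⟨0, hn⟩⟩
  obtain ⟨i, -, hi⟩ := Finset.exists_mem_eq_sup' Finset.univ_nonempty
    fun i => c (S i) (cong S (S i))
  exact ⟨i, hi⟩

/-- Raising every entering cost to at least `maxCost c hn S` implements `S`. -/
theorem implements_max_maxCost_sub (hmono : ∀ e, Monotone (c e)) (hn : 1 ≤ n)
    (S : Fin n → E) :
    Implements c (fun e => max 0 (maxCost c hn S - c e (cong S e + 1))) S := by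
  intro i e _
  calc c (S i) (cong S (S i)) + max 0 (maxCost c hn S - c (S i) (cong S (S i) + 1))
      ≤ maxCost c hn S := by
        have hL := le_maxCost c hn S i
        have hstep := hmono (S i) (Nat.le_succ (cong S (S i)))
        rw [← le_sub_iff_add_le']
        exact max_le (by linarith) (by linarith)
    _ ≤ c e (cong S e + 1) + max 0 (maxCost c hn S - c e (cong S e + 1)) := by
        linarith [le_max_right 0 (maxCost c hn S - c e (cong S e + 1))]

/-- Any implementing toll vector charges each edge whose entering cost is below
`maxCost c hn S`. -/
theorem Implements.pos_of_lt_maxCost {c : E → ℕ → ℝ} {θ : E → ℝ} {S : Fin n → E}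
    (hθ : Implements c θ S) (hθ₀ : ∀ e, 0 ≤ θ e) (hmono : ∀ e, Monotone (c e))
    (hn : 1 ≤ n) {e : E} (he : c e (cong S e + 1) < maxCost c hn S) : 0 < θ e := by
  obtain ⟨i, hi⟩ := exists_eq_maxCost c hn S
  rw [hi] at he
  have hne : e ≠ S i := by
    rintro rfl
    exact he.not_ge (hmono (S i) (Nat.le_succ _))
  linarith [hθ i e hne, hθ₀ (S i)]

end ParallelLink

/-- In an atomic parallel-link congestion game with `n ≥ 1` players and finite nonempty
edge set `E`, for every state `S` there exists a toll vector implementing `S`, and the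
minimum number of tolled edges over all toll vectors implementing `S` equals the number
of edges `e` with `c_e(n_e(S)+1) < L(S)`. -/
theorem parallelLink_min_tollbooths {E : Type*} [Fintype E] [DecidableEq E] [Nonempty E]
    (c : E → ℕ → ℝ) (hc : ∀ e k, 0 ≤ c e k) (hmono : ∀ e, Monotone (c e))
    {n : ℕ} (hn : 1 ≤ n) (S : Fin n → E) :
    (∃ θ : E → ℝ, (∀ e, 0 ≤ θ e) ∧ Implements c θ S) ∧
    IsLeast
      {k : ℕ | ∃ θ : E → ℝ, (∀ e, 0 ≤ θ e) ∧ Implements c θ S ∧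
        (Finset.univ.filter fun e => 0 < θ e).card = k}
      (Finset.univ.filter fun e => c e (cong S e + 1) < maxCost c hn S).card := by
  have hθ := implements_max_maxCost_sub c hmono hn S
  have hθ₀ : ∀ e, 0 ≤ max 0 (maxCost c hn S - c e (cong S e + 1)) := fun _ => le_max_left _ _
  refine ⟨⟨_, hθ₀, hθ⟩, ⟨_, hθ₀, hθ, ?_⟩, ?_⟩
  · simp
  · rintro _ ⟨θ, hθ₀, hθ, rfl⟩
    exact Finset.card_le_card <| Finset.monotone_filter_right _
      fun _ _ he => hθ.pos_of_lt_maxCost hθ₀ hmono hn he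
end

section
/- In an atomic parallel-link congestion game with n ≥ 1 players, if a toll vector θ implements a state S, then every edge e with l_e^+ < L(S) is tolled, i.e. θ_e > 0; in particular every implementing toll vector has at least |{e ∈ E : l_e^+ < L(S)}| tolled edges. -/
/-- In an atomic parallel-link congestion game with `n ≥ 1` players, if a toll vector `θ`
implements a state `S`, then every edge `e` with `l_e⁺ < L(S)` is tolled; in particular
every implementing toll vector has at least `|{e : l_e⁺ < L(S)}|` tolled edges. -/
theorem parallelLink_lower_bound {E : Type*} [Fintype E] [DecidableEq E] [Nonempty E]
    (c : E → ℕ → ℝ) (hc : ∀ e k, 0 ≤ c e k) (hmono : ∀ e, Monotone (c e))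
    {n : ℕ} (hn : 1 ≤ n) (S : Fin n → E)
    (θ : E → ℝ) (hθ : ∀ e, 0 ≤ θ e) (himpl : Implements c θ S) :
    (∀ e : E, c e (cong S e + 1) < maxCost c hn S → 0 < θ e) ∧
    (Finset.univ.filter fun e => c e (cong S e + 1) < maxCost c hn S).card ≤
      (Finset.univ.filter fun e => 0 < θ e).card := by
  have tolled : ∀ e : E, c e (cong S e + 1) < maxCost c hn S → 0 < θ e := by
    intro e he
    obtain ⟨i, -, hi⟩ := (Finset.lt_sup'_iff _).mp he
    have hne : e ≠ S i := by
      rintro rfl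
      exact hi.not_ge (hmono _ (Nat.le_succ _))
    linarith [himpl i e hne, hθ (S i)]
  exact ⟨tolled, Finset.card_le_card (Finset.monotone_filter_right _ fun e _ => tolled e)⟩
end

section
/- In an atomic parallel-link congestion game with n ≥ 1 players, for any state S, the minimum of the entering cost over all toll vectors θ implementing S equals max( L(S), min_{e ∈ E} l_e^+ ), and this minimum is attained by some implementing toll vector. -/
/-- The entering cost of toll vector `θ` in state `S`: the minimum over edges `e`
of `l_e⁺ + θ_e`, i.e. the least cost a newly entering player can achieve. -/
def enterCost {E : Type*} [Fintype E] [DecidableEq E] [Nonempty E] (c : E → ℕ → ℝ)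
    {n : ℕ} (θ : E → ℝ) (S : Fin n → E) : ℝ :=
  Finset.univ.inf' Finset.univ_nonempty fun e => c e (cong S e + 1) + θ e

/-- In an atomic parallel-link congestion game with `n ≥ 1` players, for any state `S`,
the minimum of the entering cost over all toll vectors implementing `S` equals
`max(L(S), min_{e} l_e⁺)`, and this minimum is attained. -/
theorem parallelLink_min_enterCost {E : Type*} [Fintype E] [DecidableEq E] [Nonempty E]
    (c : E → ℕ → ℝ) (hc : ∀ e k, 0 ≤ c e k) (hmono : ∀ e, Monotone (c e))
    {n : ℕ} (hn : 1 ≤ n) (S : Fin n → E) :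
    IsLeast
      {x : ℝ | ∃ θ : E → ℝ, (∀ e, 0 ≤ θ e) ∧ Implements c θ S ∧ enterCost c θ S = x}
      (max (maxCost c hn S)
        (Finset.univ.inf' Finset.univ_nonempty fun e => c e (cong S e + 1))) := by
  set m := Finset.univ.inf' Finset.univ_nonempty fun e => c e (cong S e + 1)
  have hL : ∀ i, c (S i) (cong S (S i)) ≤ maxCost c hn S := fun i =>
    Finset.le_sup' (fun i => c (S i) (cong S (S i))) (Finset.mem_univ i)
  constructor
  · refine ⟨fun e => max 0 (max (maxCost c hn S) m - c e (cong S e + 1)),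
      fun e => le_max_left _ _, fun i e _ => ?_, le_antisymm ?_ ?_⟩
    · have h₁ := hL i
      have h₂ := hmono (S i) (Nat.le_succ (cong S (S i)))
      have h₃ := le_max_left (maxCost c hn S) m
      have h₄ := le_max_right 0 (max (maxCost c hn S) m - c e (cong S e + 1))
      have h₅ : max 0 (max (maxCost c hn S) m - c (S i) (cong S (S i) + 1)) ≤
          max (maxCost c hn S) m - c (S i) (cong S (S i)) :=
        max_le (by linarith) (by simp only [Nat.succ_eq_add_one] at h₂; linarith)
      linarith
    · obtain ⟨e, -, he⟩ := Finset.exists_mem_eq_inf' (Finset.univ_nonempty (α := E))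
        fun e => c e (cong S e + 1)
      refine (Finset.inf'_le _ (Finset.mem_univ e)).trans (le_of_eq ?_)
      have h : c e (cong S e + 1) ≤ max (maxCost c hn S) m := he ▸ le_max_right _ _
      beta_reduce
      rw [max_eq_right (sub_nonneg.2 h)]
      ring
    · refine Finset.le_inf' _ _ fun e _ => ?_
      have := le_max_right 0 (max (maxCost c hn S) m - c e (cong S e + 1))
      linarith
  · rintro _ ⟨θ, hθ, hS, rfl⟩
    refine max_le (Finset.sup'_le _ _ fun i _ => Finset.le_inf' _ _ fun e _ => ?_)
      (Finset.le_inf' _ _ fun e _ => ?_)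
    · by_cases he : e = S i
      · subst he
        have := hmono (S i) (Nat.le_succ (cong S (S i)))
        exact this.trans (le_add_of_nonneg_right (hθ _))
      · exact (le_add_of_nonneg_right (hθ _)).trans (hS i e he)
    · exact (Finset.inf'_le _ (Finset.mem_univ e)).trans (le_add_of_nonneg_right (hθ e))
end

section
/- Let N be a two-terminal series-parallel network with cost functions, defined inductively from parallel-link networks by series and parallel compositions, and consider the symmetric atomic network congestion game on N with n ≥ 1 players. Then for every state S of this game there exists a toll vector θ : E(N) → ℝ≥0 implementing S; in particular, there is an implementing toll vector with the minimum possible number of tolled edges. -/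
noncomputable section
open scoped Classical

/-- Two-terminal series-parallel networks with cost functions, built inductively from
parallel-link networks (a finite nonempty edge set, each edge carrying a nonnegative
monotonically nondecreasing cost function `ℕ → ℝ`) by series and parallel composition. -/
inductive SPN : Type 1 where
  | link (E : Type) (fin : Fintype E) (ne : Nonempty E) (c : E → ℕ → ℝ)
      (hc : ∀ e k, 0 ≤ c e k) (hm : ∀ e, Monotone (c e)) : SPN
  | series (N₁ N₂ : SPN) : SPN
  | par (N₁ N₂ : SPN) : SPN

/-- The edge set of a series-parallel network: the disjoint union of the
component edge sets. -/
def SPN.Edges : SPN → Type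
  | .link E _ _ _ _ _ => E
  | .series N₁ N₂ => N₁.Edges ⊕ N₂.Edges
  | .par N₁ N₂ => N₁.Edges ⊕ N₂.Edges

instance SPN.edgesFintype : (N : SPN) → Fintype N.Edges
  | .link _ f _ _ _ _ => f
  | .series N₁ N₂ =>
      letI := edgesFintype N₁; letI := edgesFintype N₂
      inferInstanceAs (Fintype (N₁.Edges ⊕ N₂.Edges))
  | .par N₁ N₂ =>
      letI := edgesFintype N₁; letI := edgesFintype N₂
      inferInstanceAs (Fintype (N₁.Edges ⊕ N₂.Edges))

/-- The cost function carried by each edge. -/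
def SPN.cost : (N : SPN) → N.Edges → ℕ → ℝ
  | .link _ _ _ c _ _ => c
  | .series N₁ N₂ => Sum.elim N₁.cost N₂.cost
  | .par N₁ N₂ => Sum.elim N₁.cost N₂.cost

/-- The paths (strategies) of a series-parallel network: an edge for a parallel-link
network, a pair of paths for a series composition, and a path of one of the two
components for a parallel composition. -/
def SPN.Paths : SPN → Type
  | .link E _ _ _ _ _ => E
  | .series N₁ N₂ => N₁.Paths × N₂.Paths
  | .par N₁ N₂ => N₁.Paths ⊕ N₂.Paths

/-- Whether the path `p` uses the edge `e`. -/
def SPN.uses : (N : SPN) → N.Paths → N.Edges → Prop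
  | .link _ _ _ _ _ _, p, e => p = e
  | .series N₁ N₂, p, e => Sum.elim (N₁.uses p.1) (N₂.uses p.2) e
  | .par N₁ _, .inl p₁, e => Sum.elim (N₁.uses p₁) (fun _ => False) e
  | .par _ N₂, .inr p₂, e => Sum.elim (fun _ => False) (N₂.uses p₂) e

/-- Congestion of edge `e` in the state `S`: the number of players whose path uses `e`. -/
def SPN.cong (N : SPN) {n : ℕ} (S : Fin n → N.Paths) (e : N.Edges) : ℕ :=
  (Finset.univ.filter fun i => N.uses (S i) e).card

/-- Tolled cost of player `i` in state `S` under toll vector `θ`: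
the sum of `c_e(n_e(S)) + θ_e` over the edges their path uses. -/
def SPN.playerCost (N : SPN) {n : ℕ} (θ : N.Edges → ℝ) (S : Fin n → N.Paths)
    (i : Fin n) : ℝ :=
  ∑ e : N.Edges, if N.uses (S i) e then N.cost e (N.cong S e) + θ e else 0

/-- The toll vector `θ` implements the state `S`: `S` is a pure Nash equilibrium of the
tolled symmetric network congestion game, i.e. no player can strictly decrease their
tolled cost by unilaterally switching to another path. -/
def SPN.Implements (N : SPN) {n : ℕ} (θ : N.Edges → ℝ) (S : Fin n → N.Paths) : Prop :=
  ∀ (i : Fin n) (p : N.Paths),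
    N.playerCost θ S i ≤ N.playerCost θ (Function.update S i p) i

/-- The cost function of every edge is monotone. -/
theorem SPN.cost_monotone (N : SPN) : ∀ e, Monotone (N.cost e) := by
  induction N with
  | link E fin ne c hc hm => exact hm
  | series N₁ N₂ h₁ h₂ => rintro (e | e); exacts [h₁ e, h₂ e]
  | par N₁ N₂ h₁ h₂ => rintro (e | e); exacts [h₁ e, h₂ e]

/-- The length of a path under an edge weighting. -/
def SPN.pathWeight (N : SPN) (w : N.Edges → ℝ) (p : N.Paths) : ℝ :=
  ∑ e : N.Edges, if N.uses p e then w e else 0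

theorem SPN.pathWeight_link {E : Type} (fin : Fintype E) (ne : Nonempty E) (c : E → ℕ → ℝ)
    (hc : ∀ e k, 0 ≤ c e k) (hm : ∀ e, Monotone (c e)) (w : E → ℝ) (p : E) :
    (SPN.link E fin ne c hc hm).pathWeight w p = w p :=
  (Finset.sum_ite_eq Finset.univ p w).trans (if_pos (Finset.mem_univ p))

theorem SPN.pathWeight_series (N₁ N₂ : SPN) (w₁ : N₁.Edges → ℝ) (w₂ : N₂.Edges → ℝ)
    (p : N₁.Paths × N₂.Paths) :
    (SPN.series N₁ N₂).pathWeight (Sum.elim w₁ w₂) p =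
      N₁.pathWeight w₁ p.1 + N₂.pathWeight w₂ p.2 :=
  Fintype.sum_sum_type _

theorem SPN.pathWeight_par_inl (N₁ N₂ : SPN) (w₁ : N₁.Edges → ℝ) (w₂ : N₂.Edges → ℝ)
    (p : N₁.Paths) :
    (SPN.par N₁ N₂).pathWeight (Sum.elim w₁ w₂) (Sum.inl p) = N₁.pathWeight w₁ p := by
  refine (Fintype.sum_sum_type _).trans ?_
  refine (congrArg _ (Finset.sum_eq_zero fun e _ => if_neg id)).trans (add_zero _)

theorem SPN.pathWeight_par_inr (N₁ N₂ : SPN) (w₁ : N₁.Edges → ℝ) (w₂ : N₂.Edges → ℝ)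
    (p : N₂.Paths) :
    (SPN.par N₁ N₂).pathWeight (Sum.elim w₁ w₂) (Sum.inr p) = N₂.pathWeight w₂ p := by
  refine (Fintype.sum_sum_type _).trans ?_
  refine (congrArg (· + _) (Finset.sum_eq_zero fun e _ => if_neg id)).trans (zero_add _)

/-- Any edge weighting of a series-parallel network can be increased to one under which all
paths have the same length, and every sufficiently large length is attained. -/
theorem SPN.exists_le_pathWeight_eq (N : SPN) (a : N.Edges → ℝ) :
    ∃ L₀ : ℝ, ∀ L, L₀ ≤ L → ∃ w : N.Edges → ℝ, (∀ e, a e ≤ w e) ∧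
      ∀ p, N.pathWeight w p = L := by
  induction N with
  | link E fin ne c hc hm =>
    obtain ⟨L₀, hL₀⟩ := (Set.finite_range (show E → ℝ from a)).bddAbove
    exact ⟨L₀, fun L hL => ⟨fun _ => L, fun e => (hL₀ ⟨e, rfl⟩).trans hL,
      fun p => pathWeight_link fin ne c hc hm _ p⟩⟩
  | series N₁ N₂ h₁ h₂ =>
    obtain ⟨L₁, h₁⟩ := h₁ fun e => a (Sum.inl e)
    obtain ⟨L₂, h₂⟩ := h₂ fun e => a (Sum.inr e)
    refine ⟨L₁ + L₂, fun L hL => ?_⟩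
    obtain ⟨w₁, ha₁, hw₁⟩ := h₁ L₁ le_rfl
    obtain ⟨w₂, ha₂, hw₂⟩ := h₂ (L - L₁) (by linarith)
    refine ⟨Sum.elim w₁ w₂, ?_, fun p => ?_⟩
    · rintro (e | e); exacts [ha₁ e, ha₂ e]
    · exact (pathWeight_series ..).trans (by rw [hw₁, hw₂, add_sub_cancel])
  | par N₁ N₂ h₁ h₂ =>
    obtain ⟨L₁, h₁⟩ := h₁ fun e => a (Sum.inl e)
    obtain ⟨L₂, h₂⟩ := h₂ fun e => a (Sum.inr e)
    refine ⟨max L₁ L₂, fun L hL => ?_⟩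
    obtain ⟨w₁, ha₁, hw₁⟩ := h₁ L ((le_max_left _ _).trans hL)
    obtain ⟨w₂, ha₂, hw₂⟩ := h₂ L ((le_max_right _ _).trans hL)
    refine ⟨Sum.elim w₁ w₂, ?_, ?_⟩
    · rintro (e | e); exacts [ha₁ e, ha₂ e]
    · rintro (p | p)
      exacts [(pathWeight_par_inl ..).trans (hw₁ p), (pathWeight_par_inr ..).trans (hw₂ p)]

/-- A deviating player does not lower the congestion of the edges of their new path. -/
theorem SPN.cong_le_cong_update (N : SPN) {n : ℕ} (S : Fin n → N.Paths) (i : Fin n)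
    (p : N.Paths) (e : N.Edges) (h : N.uses p e) :
    N.cong S e ≤ N.cong (Function.update S i p) e := by
  refine Finset.card_le_card fun j hj => ?_
  simp only [Finset.mem_filter, Finset.mem_univ, true_and] at hj ⊢
  by_cases hji : j = i
  · subst hji; rwa [Function.update_self]
  · rwa [Function.update_of_ne hji]

theorem SPN.exists_implements (N : SPN) {n : ℕ} (S : Fin n → N.Paths) :
    ∃ θ : N.Edges → ℝ, (∀ e, 0 ≤ θ e) ∧ N.Implements θ S := by
  obtain ⟨L, hL⟩ := N.exists_le_pathWeight_eq fun e => N.cost e (N.cong S e)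
  obtain ⟨w, hw, hp⟩ := hL L le_rfl
  refine ⟨fun e => w e - N.cost e (N.cong S e), fun e => sub_nonneg.2 (hw e), fun i p => ?_⟩
  have hstay : N.playerCost (fun e => w e - N.cost e (N.cong S e)) S i = L := by
    simpa only [playerCost, pathWeight, add_sub_cancel] using hp (S i)
  rw [hstay, ← hp p]
  simp only [playerCost, pathWeight, Function.update_self]
  refine Finset.sum_le_sum fun e _ => ?_
  split_ifs with h
  · have := N.cost_monotone e (N.cong_le_cong_update S i p e h)
    linarith
  · exact le_rfl

/-- For every series-parallel network `N` and every state `S` of the symmetric atomic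
network congestion game on `N` with `n ≥ 1` players, there exists a toll vector
implementing `S`; in particular there is an implementing toll vector with the minimum
possible number of tolled edges. -/
theorem spn_every_state_implementable (N : SPN) {n : ℕ} (hn : 1 ≤ n)
    (S : Fin n → N.Paths) :
    (∃ θ : N.Edges → ℝ, (∀ e, 0 ≤ θ e) ∧ N.Implements θ S) ∧
    ∃ k : ℕ, IsLeast {k : ℕ | ∃ θ : N.Edges → ℝ, (∀ e, 0 ≤ θ e) ∧ N.Implements θ S ∧
      (Finset.univ.filter fun e => 0 < θ e).card = k} k := by
  obtain ⟨θ, hθ, h⟩ := N.exists_implements S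
  exact ⟨⟨θ, hθ, h⟩, _, isLeast_csInf ⟨_, θ, hθ, h, rfl⟩⟩

end
end
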